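/- arXiv:2207.08206 — 9 statements merged into one kernel-verified Lean document; each statement's English description precedes it below -/
import Mathlib

section
/- Let A(t) = 65536t⁴ − 17472t³ − 10176t² + 18672t − 3535 and B(t) = 1024(t+1)²(15t−8)²(31t−7)² in ℚ(t), and let X₁ = −361(t+1)(31t−7). Then there exists Y ∈ ℚ(t) such that Y² = X₁³ + A(t)X₁² + B(t)X₁; that is, X₁ is the X-coordinate of a ℚ(t)-rational point on the elliptic curve E: Y² = X³ + A(t)X² + B(t)X. -/
open RatFunc in
/-- X₁ = −361(t+1)(31t−7) is the X-coordinate of a ℚ(t)-rational point on the Elkies surface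
`Y² = X³ + A(t)X² + B(t)X` with `A(t) = 65536t⁴ − 17472t³ − 10176t² + 18672t − 3535` and
`B(t) = 1024(t+1)²(15t−8)²(31t−7)²`. -/
theorem statement_2 :
    let A : RatFunc ℚ := 65536 * X ^ 4 - 17472 * X ^ 3 - 10176 * X ^ 2 + 18672 * X - 3535
    let B : RatFunc ℚ := 1024 * (X + 1) ^ 2 * (15 * X - 8) ^ 2 * (31 * X - 7) ^ 2
    let x : RatFunc ℚ := -361 * (X + 1) * (31 * X - 7)
    ∃ Y : RatFunc ℚ, Y ^ 2 = x ^ 3 + A * x ^ 2 + B * x := by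
  intro A B x
  refine ⟨19 * (X + 1) * (31 * X - 7) * (4064 * X ^ 2 - 519 * X - 308), ?_⟩
  simp only [A, B, x]
  ring
end

section
/- Let A(t) = 65536t⁴ − 17472t³ − 10176t² + 18672t − 3535 and B(t) = 1024(t+1)²(15t−8)²(31t−7)² in ℚ(t), and let X₂ = −4(t+1)(15t−8)(16t−7)². Then there exists Y ∈ ℚ(t) such that Y² = X₂³ + A(t)X₂² + B(t)X₂; that is, X₂ is the X-coordinate of a ℚ(t)-rational point on the elliptic curve E: Y² = X³ + A(t)X² + B(t)X. -/
open RatFunc in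
/-- X₂ = −4(t+1)(15t−8)(16t−7)² is the X-coordinate of a ℚ(t)-rational point on the Elkies surface
`Y² = X³ + A(t)X² + B(t)X` with `A(t) = 65536t⁴ − 17472t³ − 10176t² + 18672t − 3535` and
`B(t) = 1024(t+1)²(15t−8)²(31t−7)²`. -/
theorem statement_3 :
    let A : RatFunc ℚ := 65536 * X ^ 4 - 17472 * X ^ 3 - 10176 * X ^ 2 + 18672 * X - 3535
    let B : RatFunc ℚ := 1024 * (X + 1) ^ 2 * (15 * X - 8) ^ 2 * (31 * X - 7) ^ 2
    let x : RatFunc ℚ := -4 * (X + 1) * (15 * X - 8) * (16 * X - 7) ^ 2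
    ∃ Y : RatFunc ℚ, Y ^ 2 = x ^ 3 + A * x ^ 2 + B * x := by
  intro A B x
  refine ⟨4 * (X + 1) * (15 * X - 8) * (16 * X - 7) *
    (3584 * X ^ 3 - 1968 * X ^ 2 - 314 * X + 63), ?_⟩
  simp only [A, B, x]
  ring
end

section
/- Let A(t) = 65536t⁴ − 17472t³ − 10176t² + 18672t − 3535 and B(t) = 1024(t+1)²(15t−8)²(31t−7)² in ℚ(t), and let X₃ = −16(t+1)(8t+7)²(15t−8). Then there exists Y ∈ ℚ(t) such that Y² = X₃³ + A(t)X₃² + B(t)X₃; that is, X₃ is the X-coordinate of a ℚ(t)-rational point on the elliptic curve E: Y² = X³ + A(t)X² + B(t)X. -/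
open RatFunc in
/-- X₃ = −16(t+1)(8t+7)²(15t−8) is the X-coordinate of a ℚ(t)-rational point on the Elkies surface
`Y² = X³ + A(t)X² + B(t)X` with `A(t) = 65536t⁴ − 17472t³ − 10176t² + 18672t − 3535` and
`B(t) = 1024(t+1)²(15t−8)²(31t−7)²`. -/
theorem statement_4 :
    let A : RatFunc ℚ := 65536 * X ^ 4 - 17472 * X ^ 3 - 10176 * X ^ 2 + 18672 * X - 3535
    let B : RatFunc ℚ := 1024 * (X + 1) ^ 2 * (15 * X - 8) ^ 2 * (31 * X - 7) ^ 2
    let x : RatFunc ℚ := -16 * (X + 1) * (8 * X + 7) ^ 2 * (15 * X - 8)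
    ∃ Y : RatFunc ℚ, Y ^ 2 = x ^ 3 + A * x ^ 2 + B * x := by
  intro A B x
  refine ⟨16 * (X + 1) * (15 * X - 8) * (8 * X + 7) *
    (399 + 1768 * X - 648 * X ^ 2 - 1792 * X ^ 3), ?_⟩
  simp only [A, B, x]
  ring
end

section
/- Let A(t) = 65536t⁴ − 17472t³ − 10176t² + 18672t − 3535 and B(t) = 1024(t+1)²(15t−8)²(31t−7)² in ℚ(t), and let X₄ = 4(15t−8)(16t+1)²(31t−7). Then there exists Y ∈ ℚ(t) such that Y² = X₄³ + A(t)X₄² + B(t)X₄; that is, X₄ is the X-coordinate of a ℚ(t)-rational point on the elliptic curve E: Y² = X³ + A(t)X² + B(t)X. -/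
open RatFunc in
/-- X₄ = 4(15t−8)(16t+1)²(31t−7) is the X-coordinate of a ℚ(t)-rational point on the Elkies surface
`Y² = X³ + A(t)X² + B(t)X` with `A(t) = 65536t⁴ − 17472t³ − 10176t² + 18672t − 3535` and
`B(t) = 1024(t+1)²(15t−8)²(31t−7)²`. -/
theorem statement_5 :
    let A : RatFunc ℚ := 65536 * X ^ 4 - 17472 * X ^ 3 - 10176 * X ^ 2 + 18672 * X - 3535
    let B : RatFunc ℚ := 1024 * (X + 1) ^ 2 * (15 * X - 8) ^ 2 * (31 * X - 7) ^ 2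
    let x : RatFunc ℚ := 4 * (15 * X - 8) * (16 * X + 1) ^ 2 * (31 * X - 7)
    ∃ Y : RatFunc ℚ, Y ^ 2 = x ^ 3 + A * x ^ 2 + B * x := by
  intro A B x
  refine ⟨4 * (15 * X - 8) * (31 * X - 7) * (16 * X + 1) *
    (11776 * X ^ 3 - 2736 * X ^ 2 - 682 * X + 105), ?_⟩
  simp only [A, B, x]
  ring
end

section
/- Let u be the variable of the rational function field ℚ(u) and set t = 4(u² − 1)/(7u² + 17) ∈ ℚ(u). Then the element −(7t − 4)(17t + 4) is a square in ℚ(u); that is, there exists f ∈ ℚ(u) with f² = −(7t − 4)(17t + 4). -/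
theorem RatFunc.seven_mul_X_sq_add_seventeen_ne_zero :
    (7 * RatFunc.X ^ 2 + 17 : RatFunc ℚ) ≠ 0 := by
  have hp : (7 * Polynomial.X ^ 2 + 17 : Polynomial ℚ) ≠ 0 := fun h => by
    simpa using congrArg (Polynomial.eval 0) h
  have h := RatFunc.algebraMap_ne_zero hp
  rwa [map_add, map_mul, map_pow, RatFunc.algebraMap_X, map_ofNat, map_ofNat] at h

theorem sq_ninetySix_mul_div_eq {K : Type*} [Field K] {x : K} (hx : 7 * x ^ 2 + 17 ≠ 0) :
    (96 * x / (7 * x ^ 2 + 17)) ^ 2 =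
      -((7 * (4 * (x ^ 2 - 1) / (7 * x ^ 2 + 17)) - 4) *
        (17 * (4 * (x ^ 2 - 1) / (7 * x ^ 2 + 17)) + 4)) := by
  obtain ⟨d, hd⟩ : ∃ d, d = 7 * x ^ 2 + 17 := ⟨_, rfl⟩
  rw [← hd] at hx ⊢
  field_simp
  rw [hd]
  ring

open RatFunc in
/-- With `t = 4(u² − 1)/(7u² + 17) ∈ ℚ(u)`, the element `−(7t − 4)(17t + 4)` is a square
in `ℚ(u)`. -/
theorem statement_7 :
    let t : RatFunc ℚ := 4 * (X ^ 2 - 1) / (7 * X ^ 2 + 17)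
    ∃ f : RatFunc ℚ, f ^ 2 = -((7 * t - 4) * (17 * t + 4)) :=
  ⟨_, sq_ninetySix_mul_div_eq seven_mul_X_sq_add_seventeen_ne_zero⟩
end

section
/- Let u be the variable of the rational function field ℚ(u) and set t = 4(u² − 331)/(7(u² − 793)) ∈ ℚ(u). Then the element (7t − 4)(5551t − 1324) is a square in ℚ(u); that is, there exists f ∈ ℚ(u) with f² = (7t − 4)(5551t − 1324). -/
theorem RatFunc.X_sq_sub_natCast_ne_zero (n : ℕ) :
    (RatFunc.X : RatFunc ℚ) ^ 2 - n ≠ 0 := by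
  have h : (Polynomial.X ^ 2 - Polynomial.C (n : ℚ)) ≠ 0 :=
    Polynomial.X_pow_sub_C_ne_zero two_pos _
  simpa using RatFunc.algebraMap_ne_zero h

open RatFunc in
/-- With `t = 4(u² − 331)/(7(u² − 793)) ∈ ℚ(u)`, the element `(7t − 4)(5551t − 1324)` is a
square in `ℚ(u)`. -/
theorem statement_9 :
    let t : RatFunc ℚ := 4 * (X ^ 2 - 331) / (7 * (X ^ 2 - 793))
    ∃ f : RatFunc ℚ, f ^ 2 = (7 * t - 4) * (5551 * t - 1324) := by
  intro t
  have hD : (X ^ 2 - 793 : RatFunc ℚ) ≠ 0 := mod_cast X_sq_sub_natCast_ne_zero 793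
  refine ⟨1848 * X / (X ^ 2 - 793), ?_⟩
  simp only [t]
  field_simp
  ring
end

section
/- Let u be the variable of the rational function field ℚ(u), set t = 4(u² − 331)/(7(u² − 793)) ∈ ℚ(u), and let A(t) = 65536t⁴ − 17472t³ − 10176t² + 18672t − 3535, B(t) = 1024(t+1)²(15t−8)²(31t−7)², and X₆ = 576(7t−4)(15t−8)²(5551t−1324)/(49(28t−39)²), all viewed as elements of ℚ(u). Then there exists Y ∈ ℚ(u) such that Y² = X₆³ + A(t)X₆² + B(t)X₆; that is, X₆ is the X-coordinate of a ℚ(u)-rational point on the curve Y² = X³ + A(t)X² + B(t)X over ℚ(u). -/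
/-- If `(7t − 4)(5551t − 1324)` is a square in a field of characteristic zero, then
`576(7t−4)(15t−8)²(5551t−1324)/(49(28t−39)²)` is the X-coordinate of a point on the fibre at `t`
of the Elkies K3 surface. -/
theorem exists_point_of_sq_eq {K : Type*} [Field K] [CharZero K] {s t : K}
    (hs : s ^ 2 = (7 * t - 4) * (5551 * t - 1324)) :
    let A : K := 65536 * t ^ 4 - 17472 * t ^ 3 - 10176 * t ^ 2 + 18672 * t - 3535
    let B : K := 1024 * (t + 1) ^ 2 * (15 * t - 8) ^ 2 * (31 * t - 7) ^ 2
    let x : K :=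
      576 * (7 * t - 4) * (15 * t - 8) ^ 2 * (5551 * t - 1324) / (49 * (28 * t - 39) ^ 2)
    ∃ Y : K, Y ^ 2 = x ^ 3 + A * x ^ 2 + B * x := by
  intro A B x
  by_cases hD : 28 * t - 39 = 0
  · exact ⟨0, by simp [x, hD]⟩
  · refine ⟨24 * s * (15 * t - 8) ^ 2 *
      (240418304 * t ^ 4 - 464764608 * t ^ 3 + 396600736 * t ^ 2 - 109990392 * t + 8400960) /
        (343 * (28 * t - 39) ^ 3), ?_⟩
    simp only [x, A, B, div_pow, mul_pow, hs]
    field_simp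
    ring

open RatFunc in
theorem RatFunc.X_sq_sub_793_ne_zero : (X ^ 2 - 793 : RatFunc ℚ) ≠ 0 := by
  have h : (Polynomial.X ^ 2 - Polynomial.C 793 : Polynomial ℚ) ≠ 0 :=
    Polynomial.X_pow_sub_C_ne_zero two_pos 793
  simpa using RatFunc.algebraMap_ne_zero h

open RatFunc in
/-- With `t = 4(u² − 331)/(7(u² − 793)) ∈ ℚ(u)`, the element
`X₆ = 576(7t−4)(15t−8)²(5551t−1324)/(49(28t−39)²)` is the X-coordinate of a `ℚ(u)`-rational
point on the curve `Y² = X³ + A(t)X² + B(t)X`, where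
`A(t) = 65536t⁴ − 17472t³ − 10176t² + 18672t − 3535` and
`B(t) = 1024(t+1)²(15t−8)²(31t−7)²`. -/
theorem statement_10 :
    let t : RatFunc ℚ := 4 * (X ^ 2 - 331) / (7 * (X ^ 2 - 793))
    let A : RatFunc ℚ := 65536 * t ^ 4 - 17472 * t ^ 3 - 10176 * t ^ 2 + 18672 * t - 3535
    let B : RatFunc ℚ := 1024 * (t + 1) ^ 2 * (15 * t - 8) ^ 2 * (31 * t - 7) ^ 2
    let x : RatFunc ℚ :=
      576 * (7 * t - 4) * (15 * t - 8) ^ 2 * (5551 * t - 1324) / (49 * (28 * t - 39) ^ 2)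
    ∃ Y : RatFunc ℚ, Y ^ 2 = x ^ 3 + A * x ^ 2 + B * x := by
  intro t
  have hw := RatFunc.X_sq_sub_793_ne_zero
  refine exists_point_of_sq_eq (s := 1848 * X / (X ^ 2 - 793)) ?_
  simp only [t]
  field_simp
  ring
end

section
/- Let r be the variable of the rational function field ℚ(r) and set t = 4(3r² − 14r − 5390)(10r² − 14r − 1617)/(7(72r⁴ − 182r³ − 13279r² + 98098r + 20917512)) ∈ ℚ(r). Then both −(7t − 4)(17t + 4) and (7t − 4)(5551t − 1324) are squares in ℚ(r); that is, there exist f, g ∈ ℚ(r) with f² = −(7t − 4)(17t + 4) and g² = (7t − 4)(5551t − 1324). -/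
/-- The quartic in the denominator of the parametrization is nonzero in `ℚ(r)`. -/
theorem parametrization_denominator_ne_zero :
    (72 * RatFunc.X ^ 4 - 182 * RatFunc.X ^ 3 - 13279 * RatFunc.X ^ 2 + 98098 * RatFunc.X
      + 20917512 : RatFunc ℚ) ≠ 0 := by
  have hp : (72 * Polynomial.X ^ 4 - 182 * Polynomial.X ^ 3 - 13279 * Polynomial.X ^ 2
      + 98098 * Polynomial.X + 20917512 : Polynomial ℚ) ≠ 0 := by
    intro h
    have h0 := congrArg (Polynomial.eval 0) h
    norm_num at h0
  have h := (map_ne_zero_iff _ (RatFunc.algebraMap_injective ℚ)).mpr hp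
  simpa only [map_add, map_sub, map_mul, map_pow, map_ofNat, RatFunc.algebraMap_X] using h

open RatFunc in
/-- With `t = 4(3r² − 14r − 5390)(10r² − 14r − 1617)/(7(72r⁴ − 182r³ − 13279r² + 98098r
+ 20917512)) ∈ ℚ(r)`, both `−(7t − 4)(17t + 4)` and `(7t − 4)(5551t − 1324)` are squares
in `ℚ(r)`. -/
theorem statement_12 :
    let t : RatFunc ℚ :=
      4 * (3 * X ^ 2 - 14 * X - 5390) * (10 * X ^ 2 - 14 * X - 1617) /
        (7 * (72 * X ^ 4 - 182 * X ^ 3 - 13279 * X ^ 2 + 98098 * X + 20917512))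
    (∃ f : RatFunc ℚ, f ^ 2 = -((7 * t - 4) * (17 * t + 4))) ∧
      ∃ g : RatFunc ℚ, g ^ 2 = (7 * t - 4) * (5551 * t - 1324) := by
  intro t
  have hD := parametrization_denominator_ne_zero
  set D : RatFunc ℚ := 72 * X ^ 4 - 182 * X ^ 3 - 13279 * X ^ 2 + 98098 * X + 20917512 with hDef
  have ht : t = 4 * (3 * X ^ 2 - 14 * X - 5390) * (10 * X ^ 2 - 14 * X - 1617) / (7 * D) := rfl
  have h₁ : 7 * t - 4 = -168 * (X ^ 2 + 539) ^ 2 / D := by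
    rw [ht]
    field_simp
    rw [hDef]
    ring
  have h₂ : 17 * t + 4 = 24 * (13 * X ^ 2 - 28 * X - 7007) ^ 2 / (7 * D) := by
    rw [ht]
    field_simp
    rw [hDef]
    ring
  have h₃ : 5551 * t - 1324 = -168 * (X ^ 2 + 1001 * X - 539) ^ 2 / D := by
    rw [ht]
    field_simp
    rw [hDef]
    ring
  refine ⟨⟨24 * (X ^ 2 + 539) * (13 * X ^ 2 - 28 * X - 7007) / D, ?_⟩,
    ⟨168 * (X ^ 2 + 539) * (X ^ 2 + 1001 * X - 539) / D, ?_⟩⟩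
  · rw [h₁, h₂]
    field_simp
    ring
  · rw [h₁, h₃]
    field_simp
end

section
/- Let E₆ be the elliptic curve over ℚ(r) given by y² = x³ + a₆(r)x² + b₆(r)x. Then for each i ∈ {1,2,3,4,5,6} there exists yᵢ ∈ ℚ(r) such that yᵢ² = xᵢ³ + a₆(r)xᵢ² + b₆(r)xᵢ, where x₁ = −53067(r−224)(r+154)(2r−7)(32r+77)(24r²−1001r+14014)(26r²+1001r+12936)(72r⁴−182r³−13279r²+98098r+20917512)², x₂ = −48(r−224)(r+154)(2r−7)(32r+77)(18r²+14r+16709)(31r²−14r+9702)(2424r⁴−12922r³−3840473r²+6964958r+704222904)², x₃ = 144(18r²+14r+16709)(24r²−1001r+14014)(26r²+1001r+12936)(31r²−14r+9702)(536r⁴+910r³+1032283r²−490490r+155719256)², x₄ = 576(18r²+14r+16709)(24r²−1001r+14014)(26r²+1001r+12936)(31r²−14r+9702)(1496r⁴−4914r³−841477r²+2648646r+434619416)², x₅ = 88510464(r²+539)²(13r²−28r−7007)²(24r²−1001r+14014)²(26r²+1001r+12936)²(72r⁴−182r³−13279r²+98098r+20917512)²/(984r⁴−4186r³−1029833r²+2256254r+285872664)²,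 x₆ = 260112384(r²+539)²(r²+1001r−539)²(18r²+14r+16709)²(31r²−14r+9702)²(72r⁴−182r³−13279r²+98098r+20917512)²/(2328r⁴−4186r³+418999r²+2256254r+676332888)². That is, each xᵢ is the x-coordinate of a ℚ(r)-rational point on E₆. -/
noncomputable section

variable {F : Type*} [Field F]

/-- The coefficient `a₆(r)` of the rank-6 curve `E₆ : y² = x³ + a₆(r)x² + b₆(r)x`. -/
def a6 (r : F) : F :=
  3 * (6637977907200 * r ^ 16 - 327957190299648 * r ^ 15 - 132939477324670464 * r ^ 14 +
    1334557851651990784 * r ^ 13 + 73205200037549219248 * r ^ 12 -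
    1718125119359074284768 * r ^ 11 - 193538301177692188691736 * r ^ 10 +
    1905189555626165277886872 * r ^ 9 + 96624855648992854220247819 * r ^ 8 -
    1026897170482503084781024008 * r ^ 7 - 56226940796444312350911834456 * r ^ 6 +
    269042619584910197333660344992 * r ^ 5 + 6178698341397939354226782536368 * r ^ 4 -
    60712935351132451806093801142016 * r ^ 3 - 3259766993714464579957766495983104 * r ^ 2 +
    4334495070152077221968455683796992 * r + 47287453161693896431461711200563200)

/-- The coefficient `b₆(r)` of the rank-6 curve `E₆ : y² = x³ + a₆(r)x² + b₆(r)x`. -/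
def b6 (r : F) : F :=
  7225344 * (r - 224) ^ 2 * (r + 154) ^ 2 * (2 * r - 7) ^ 2 * (32 * r + 77) ^ 2 *
    (18 * r ^ 2 + 14 * r + 16709) ^ 2 * (24 * r ^ 2 - 1001 * r + 14014) ^ 2 *
    (26 * r ^ 2 + 1001 * r + 12936) ^ 2 * (31 * r ^ 2 - 14 * r + 9702) ^ 2 *
    (72 * r ^ 4 - 182 * r ^ 3 - 13279 * r ^ 2 + 98098 * r + 20917512) ^ 2

/-- The curve `E₆ : y² = x³ + a₆(r)x² + b₆(r)x` (as a Weierstrass curve with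
`a₁ = a₃ = a₆ = 0`, `a₂ = a₆(r)`, `a₄ = b₆(r)`). -/
def E6 (r : F) : WeierstrassCurve.Affine F :=
  { a₁ := 0, a₂ := a6 r, a₃ := 0, a₄ := b6 r, a₆ := 0 }

/-- `x₁` -/
def x1 (r : F) : F :=
  -53067 * (r - 224) * (r + 154) * (2 * r - 7) * (32 * r + 77) *
    (24 * r ^ 2 - 1001 * r + 14014) * (26 * r ^ 2 + 1001 * r + 12936) *
    (72 * r ^ 4 - 182 * r ^ 3 - 13279 * r ^ 2 + 98098 * r + 20917512) ^ 2

/-- `x₂` -/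
def x2 (r : F) : F :=
  -48 * (r - 224) * (r + 154) * (2 * r - 7) * (32 * r + 77) *
    (18 * r ^ 2 + 14 * r + 16709) * (31 * r ^ 2 - 14 * r + 9702) *
    (2424 * r ^ 4 - 12922 * r ^ 3 - 3840473 * r ^ 2 + 6964958 * r + 704222904) ^ 2

/-- `x₃` -/
def x3 (r : F) : F :=
  144 * (18 * r ^ 2 + 14 * r + 16709) * (24 * r ^ 2 - 1001 * r + 14014) *
    (26 * r ^ 2 + 1001 * r + 12936) * (31 * r ^ 2 - 14 * r + 9702) *
    (536 * r ^ 4 + 910 * r ^ 3 + 1032283 * r ^ 2 - 490490 * r + 155719256) ^ 2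

/-- `x₄` -/
def x4 (r : F) : F :=
  576 * (18 * r ^ 2 + 14 * r + 16709) * (24 * r ^ 2 - 1001 * r + 14014) *
    (26 * r ^ 2 + 1001 * r + 12936) * (31 * r ^ 2 - 14 * r + 9702) *
    (1496 * r ^ 4 - 4914 * r ^ 3 - 841477 * r ^ 2 + 2648646 * r + 434619416) ^ 2

/-- `x₅` -/
def x5 (r : F) : F :=
  88510464 * (r ^ 2 + 539) ^ 2 * (13 * r ^ 2 - 28 * r - 7007) ^ 2 *
    (24 * r ^ 2 - 1001 * r + 14014) ^ 2 * (26 * r ^ 2 + 1001 * r + 12936) ^ 2 *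
    (72 * r ^ 4 - 182 * r ^ 3 - 13279 * r ^ 2 + 98098 * r + 20917512) ^ 2 /
    (984 * r ^ 4 - 4186 * r ^ 3 - 1029833 * r ^ 2 + 2256254 * r + 285872664) ^ 2

/-- `x₆` -/
def x6 (r : F) : F :=
  260112384 * (r ^ 2 + 539) ^ 2 * (r ^ 2 + 1001 * r - 539) ^ 2 *
    (18 * r ^ 2 + 14 * r + 16709) ^ 2 * (31 * r ^ 2 - 14 * r + 9702) ^ 2 *
    (72 * r ^ 4 - 182 * r ^ 3 - 13279 * r ^ 2 + 98098 * r + 20917512) ^ 2 /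
    (2328 * r ^ 4 - 4186 * r ^ 3 + 418999 * r ^ 2 + 2256254 * r + 676332888) ^ 2

end

noncomputable section

variable {F : Type*} [Field F]

/-- The `y`-coordinate of a point of `E₆` with `x`-coordinate `x₁`. -/
def y1 (r : F) : F :=
  67032 * (r - 224) * (r + 154) * (2 * r - 7) * (32 * r + 77) * (24 * r ^ 2 - 1001 * r + 14014) *
    (26 * r ^ 2 + 1001 * r + 12936) * (72 * r ^ 4 - 182 * r ^ 3 - 13279 * r ^ 2 + 98098 * r +
    20917512) ^ 2 * (2129352 * r ^ 8 + 1864954 * r ^ 7 + 5473426077 * r ^ 6 -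
    47796315294 * r ^ 5 - 7417856013253 * r ^ 4 + 25762213943466 * r ^ 3 +
    1590145217316117 * r ^ 2 - 292034674257326 * r + 179722528780796232)

lemma y1_sq (r : F) : y1 r ^ 2 = x1 r ^ 3 + a6 r * x1 r ^ 2 + b6 r * x1 r := by
  unfold y1 x1 a6 b6
  ring

/-- The `y`-coordinate of a point of `E₆` with `x`-coordinate `x₂`. -/
def y2 (r : F) : F :=
  144 * (r - 224) * (r + 154) * (2 * r - 7) * (32 * r + 77) * (18 * r ^ 2 + 14 * r + 16709) *
    (31 * r ^ 2 - 14 * r + 9702) * (2424 * r ^ 4 - 12922 * r ^ 3 - 3840473 * r ^ 2 + 6964958 * r +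
    704222904) * (2284669440 * r ^ 12 - 16683069312 * r ^ 11 - 1074692277344 * r ^ 10 -
    157525862823784 * r ^ 9 - 39730021847197220 * r ^ 8 + 444069834687141026 * r ^ 7 +
    43748053075043997883 * r ^ 6 - 239353640896369013014 * r ^ 5 -
    11542405677069583551620 * r ^ 4 + 24667103873257989239096 * r ^ 3 -
    90706662752544664452704 * r ^ 2 + 758961559698682413161088 * r + 56021658742282635683043840)

lemma y2_sq (r : F) : y2 r ^ 2 = x2 r ^ 3 + a6 r * x2 r ^ 2 + b6 r * x2 r := by
  unfold y2 x2 a6 b6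
  ring

/-- The `y`-coordinate of a point of `E₆` with `x`-coordinate `x₃`. -/
def y3 (r : F) : F :=
  1008 * (18 * r ^ 2 + 14 * r + 16709) * (24 * r ^ 2 - 1001 * r + 14014) * (26 * r ^ 2 +
    1001 * r + 12936) * (31 * r ^ 2 - 14 * r + 9702) * (536 * r ^ 4 + 910 * r ^ 3 +
    1032283 * r ^ 2 - 490490 * r + 155719256) * (456933888 * r ^ 12 - 6760930176 * r ^ 11 -
    1875981352672 * r ^ 10 + 11891312888728 * r ^ 9 + 399608306897660 * r ^ 8 +
    1739059301299138 * r ^ 7 + 584954904588086123 * r ^ 6 - 937352963400235382 * r ^ 5 +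
    116094604928215080860 * r ^ 4 - 1862070424231173388232 * r ^ 3 -
    158337425023119975600352 * r ^ 2 + 307574464592073223569024 * r + 11204331748456527136608768)

lemma y3_sq (r : F) : y3 r ^ 2 = x3 r ^ 3 + a6 r * x3 r ^ 2 + b6 r * x3 r := by
  unfold y3 x3 a6 b6
  ring

/-- The `y`-coordinate of a point of `E₆` with `x`-coordinate `x₄`. -/
def y4 (r : F) : F :=
  4032 * (18 * r ^ 2 + 14 * r + 16709) * (24 * r ^ 2 - 1001 * r + 14014) * (26 * r ^ 2 +
    1001 * r + 12936) * (31 * r ^ 2 - 14 * r + 9702) * (1496 * r ^ 4 - 4914 * r ^ 3 -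
    841477 * r ^ 2 + 2648646 * r + 434619416) * (4627339776 * r ^ 12 - 41021914752 * r ^ 11 -
    5412131647328 * r ^ 10 + 43797640658408 * r ^ 9 + 3389104008080980 * r ^ 8 -
    27901647165111538 * r ^ 7 - 2067435291933466931 * r ^ 6 + 15038987821995118982 * r ^ 5 +
    984605885531694390580 * r ^ 4 - 6858308420967807956152 * r ^ 3 -
    456797178555900857399648 * r ^ 2 + 1866206740483289119563648 * r +
    113465539161613932705409536)

lemma y4_sq (r : F) : y4 r ^ 2 = x4 r ^ 3 + a6 r * x4 r ^ 2 + b6 r * x4 r := by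
  unfold y4 x4 a6 b6
  ring

/-- The `y`-coordinate of a point of `E₆` with `x`-coordinate `x₅`. -/
def y5 (r : F) : F :=
  12644352 * (24 * r ^ 2 - 1001 * r + 14014) ^ 2 * (26 * r ^ 2 + 1001 * r + 12936) ^ 2 *
    (72 * r ^ 4 - 182 * r ^ 3 - 13279 * r ^ 2 + 98098 * r + 20917512) ^ 2 * (r ^ 2 + 539) *
    (13 * r ^ 2 - 28 * r - 7007) * (643807941120 * r ^ 16 - 12205514176128 * r ^ 15 -
    3248290641837024 * r ^ 14 + 38209830994176296 * r ^ 13 + 3182384124977958068 * r ^ 12 -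
    20569661918126827506 * r ^ 11 + 148355511041023173069 * r ^ 10 -
    9763780217278959562782 * r ^ 9 - 1103206047812555477953176 * r ^ 8 +
    5262677537113359204339498 * r ^ 7 + 43100391423149093263178949 * r ^ 6 +
    3221020206312590865036267414 * r ^ 5 + 268601021575061381029704175988 * r ^ 4 -
    1738276835324527269967017726904 * r ^ 3 - 79650310301670595004389050135264 * r ^ 2 +
    161315996690787881799941459286912 * r + 4586342149138055798500907592798720) / (984 * r ^ 4 -
    4186 * r ^ 3 - 1029833 * r ^ 2 + 2256254 * r + 285872664) ^ 3

lemma y5_sq (r : F) : y5 r ^ 2 = x5 r ^ 3 + a6 r * x5 r ^ 2 + b6 r * x5 r := by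
  unfold y5 x5 a6 b6
  by_cases hD : (984 * r ^ 4 - 4186 * r ^ 3 - 1029833 * r ^ 2 + 2256254 * r + 285872664) = 0
  · simp [hD]
  · field_simp
    ring

/-- The `y`-coordinate of a point of `E₆` with `x`-coordinate `x₆`. -/
def y6 (r : F) : F :=
  43352064 * (18 * r ^ 2 + 14 * r + 16709) ^ 2 * (31 * r ^ 2 - 14 * r + 9702) ^ 2 * (72 * r ^ 4 -
    182 * r ^ 3 - 13279 * r ^ 2 + 98098 * r + 20917512) ^ 2 * (r ^ 2 + 539) * (r ^ 2 + 1001 * r -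
    539) * (225266918400 * r ^ 16 + 742795312896 * r ^ 15 + 1298954623326528 * r ^ 14 -
    41162621240909168 * r ^ 13 - 7604922658893912296 * r ^ 12 + 44458185177789673836 * r ^ 11 -
    1149509565123866551878 * r ^ 10 - 42806252681281120075044 * r ^ 9 -
    5867325842338177956509463 * r ^ 8 + 23072570195210523720448716 * r ^ 7 -
    333956668369350834518148438 * r ^ 6 - 6961743628243745635722111684 * r ^ 5 -
    641874115429854039333652818536 * r ^ 4 + 1872607889713389944783512276432 * r ^ 3 +
    31851256621924717205003899007808 * r ^ 2 - 9817264926980432627674913328384 * r +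
    1604750573388458681793326546150400) / (2328 * r ^ 4 - 4186 * r ^ 3 + 418999 * r ^ 2 +
    2256254 * r + 676332888) ^ 3

lemma y6_sq (r : F) : y6 r ^ 2 = x6 r ^ 3 + a6 r * x6 r ^ 2 + b6 r * x6 r := by
  unfold y6 x6 a6 b6
  by_cases hD : (2328 * r ^ 4 - 4186 * r ^ 3 + 418999 * r ^ 2 + 2256254 * r + 676332888) = 0
  · simp [hD]
  · field_simp
    ring

end

open RatFunc in
/-- Each of `x₁, …, x₆` is the x-coordinate of a `ℚ(r)`-rational point on
`E₆ : y² = x³ + a₆(r)x² + b₆(r)x`. -/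
theorem statement_13 :
    (∃ y : RatFunc ℚ, y ^ 2 = x1 X ^ 3 + a6 X * x1 X ^ 2 + b6 X * x1 X) ∧
    (∃ y : RatFunc ℚ, y ^ 2 = x2 X ^ 3 + a6 X * x2 X ^ 2 + b6 X * x2 X) ∧
    (∃ y : RatFunc ℚ, y ^ 2 = x3 X ^ 3 + a6 X * x3 X ^ 2 + b6 X * x3 X) ∧
    (∃ y : RatFunc ℚ, y ^ 2 = x4 X ^ 3 + a6 X * x4 X ^ 2 + b6 X * x4 X) ∧
    (∃ y : RatFunc ℚ, y ^ 2 = x5 X ^ 3 + a6 X * x5 X ^ 2 + b6 X * x5 X) ∧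
    (∃ y : RatFunc ℚ, y ^ 2 = x6 X ^ 3 + a6 X * x6 X ^ 2 + b6 X * x6 X) := by
  exact ⟨⟨y1 X, y1_sq X⟩, ⟨y2 X, y2_sq X⟩, ⟨y3 X, y3_sq X⟩,
    ⟨y4 X, y4_sq X⟩, ⟨y5 X, y5_sq X⟩, ⟨y6 X, y6_sq X⟩⟩
end
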